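/- arXiv:2604.11076 — 3 statements merged into one kernel-verified Lean document; each statement's English description precedes it below -/
import Mathlib

section
/- For γ ∈ (0,1] there exists C_γ > 0 such that for all λ > 0, |Σ_{k≥1}(λ - π²k²)₊^γ − L^{sc}_{γ,1} λ^{γ+1/2} + (1/2)λ^γ| ≤ C_γ λ^{γ/2}, where L^{sc}_{γ,1} = Γ(1+γ)/((4π)^{1/2} Γ(γ+3/2)). -/
open Real

/-- The Hermite–Hadamard inequalities for a continuous concave function. -/
theorem ConcaveOn.hermite_hadamard {f : ℝ → ℝ} {a b : ℝ} (hab : a ≤ b)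
    (hf : ConcaveOn ℝ (Set.Icc a b) f) (hc : Continuous f) :
    (b - a) * ((f a + f b) / 2) ≤ ∫ x in a..b, f x ∧
      ∫ x in a..b, f x ≤ (b - a) * f ((a + b) / 2) := by
  have hrefl : ∫ x in a..b, f (a + b - x) = ∫ x in a..b, f x := by
    rw [intervalIntegral.integral_comp_sub_left]
    simp
  have hc' : Continuous fun x => f (a + b - x) := by fun_prop
  have hsum : ∫ x in a..b, (f x + f (a + b - x)) = 2 * ∫ x in a..b, f x := by
    rw [intervalIntegral.integral_add (hc.intervalIntegrable _ _) (hc'.intervalIntegrable _ _),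
      hrefl]
    ring
  have hlow : ∫ _ in a..b, (f a + f b) ≤ ∫ x in a..b, (f x + f (a + b - x)) := by
    refine intervalIntegral.integral_mono_on hab (by simp)
      ((hc.add hc').intervalIntegrable _ _) fun x hx => ?_
    rcases hab.eq_or_lt with rfl | hlt
    · obtain rfl : x = a := le_antisymm hx.2 hx.1
      simp
    have hba : 0 < b - a := sub_pos.2 hlt
    have hs : 0 ≤ (b - x) / (b - a) := div_nonneg (by linarith [hx.2]) hba.le
    have ht : 0 ≤ (x - a) / (b - a) := div_nonneg (by linarith [hx.1]) hba.le
    have hst : (b - x) / (b - a) + (x - a) / (b - a) = 1 := by field_simp; ring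
    have h1 := hf.2 (Set.left_mem_Icc.2 hab) (Set.right_mem_Icc.2 hab) hs ht hst
    have h2 := hf.2 (Set.left_mem_Icc.2 hab) (Set.right_mem_Icc.2 hab) ht hs
      (by rw [add_comm]; exact hst)
    simp only [smul_eq_mul] at h1 h2
    have e1 : (b - x) / (b - a) * a + (x - a) / (b - a) * b = x := by field_simp; ring
    have e2 : (x - a) / (b - a) * a + (b - x) / (b - a) * b = a + b - x := by field_simp; ring
    rw [e1] at h1
    rw [e2] at h2
    have e3 : (b - x) / (b - a) * f a + (x - a) / (b - a) * f b
        + ((x - a) / (b - a) * f a + (b - x) / (b - a) * f b)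
        = ((b - x) / (b - a) + (x - a) / (b - a)) * (f a + f b) := by ring
    rw [hst] at e3
    linarith
  have hupp : ∫ x in a..b, (f x + f (a + b - x)) ≤ ∫ _ in a..b, 2 * f ((a + b) / 2) := by
    refine intervalIntegral.integral_mono_on hab ((hc.add hc').intervalIntegrable _ _)
      (by simp) fun x hx => ?_
    have h := hf.2 hx (show a + b - x ∈ Set.Icc a b from ⟨by linarith [hx.2], by linarith [hx.1]⟩)
      (show (0 : ℝ) ≤ 1 / 2 by norm_num) (show (0 : ℝ) ≤ 1 / 2 by norm_num) (by norm_num)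
    simp only [smul_eq_mul] at h
    rw [show 1 / 2 * x + 1 / 2 * (a + b - x) = (a + b) / 2 by ring] at h
    linarith
  simp only [intervalIntegral.integral_const, smul_eq_mul, hsum] at hlow hupp
  constructor <;> linarith

/-- Trapezoidal rule: the trapezoidal sums of a concave function are below its integral. -/
theorem ConcaveOn.trapezoid_le_integral {f : ℝ → ℝ} {X : ℝ}
    (hf : ConcaveOn ℝ (Set.Icc 0 X) f) (hc : Continuous f) (m : ℕ) (hm : (m : ℝ) ≤ X) :
    ∑ k ∈ Finset.range m, f ((k : ℝ) + 1) + f 0 / 2 - f m / 2 ≤ ∫ x in (0 : ℝ)..m, f x := by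
  induction m with
  | zero => simp
  | succ m ih =>
    push_cast at hm ⊢
    have ih := ih (by linarith)
    have hm0 : (0 : ℝ) ≤ m := m.cast_nonneg
    have h := (ConcaveOn.hermite_hadamard (a := m) (b := m + 1) (by linarith)
      (hf.subset (Set.Icc_subset_Icc hm0 hm) (convex_Icc _ _)) hc).1
    rw [Finset.sum_range_succ, ← intervalIntegral.integral_add_adjacent_intervals
      (hc.intervalIntegrable 0 m) (hc.intervalIntegrable m (m + 1))]
    linarith

/-- Midpoint rule: the midpoint sums of a concave decreasing function, with half a step at the
origin, are above its integral. -/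
theorem ConcaveOn.integral_le_midpoint {f : ℝ → ℝ} {X : ℝ}
    (hf : ConcaveOn ℝ (Set.Icc 0 X) f) (ha : AntitoneOn f (Set.Icc 0 X)) (hc : Continuous f)
    (m : ℕ) (hm : (m : ℝ) + 1 / 2 ≤ X) :
    ∫ x in (0 : ℝ)..m + 1 / 2, f x ≤ f 0 / 2 + ∑ k ∈ Finset.range m, f ((k : ℝ) + 1) := by
  induction m with
  | zero =>
    norm_num at hm ⊢
    have h : ∫ x in (0 : ℝ)..1 / 2, f x ≤ ∫ _ in (0 : ℝ)..1 / 2, f 0 := by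
      refine intervalIntegral.integral_mono_on (by norm_num) (hc.intervalIntegrable _ _)
        (by simp) fun x hx => ?_
      exact ha ⟨le_rfl, by linarith⟩ ⟨hx.1, hx.2.trans hm⟩ hx.1
    rw [intervalIntegral.integral_const, smul_eq_mul] at h
    linarith
  | succ m ih =>
    push_cast at hm ⊢
    have ih := ih (by linarith)
    have hm0 : (0 : ℝ) ≤ m := m.cast_nonneg
    have h := (ConcaveOn.hermite_hadamard (a := m + 1 / 2) (b := m + 1 + 1 / 2) (by linarith)
      (hf.subset (Set.Icc_subset_Icc (by linarith) hm) (convex_Icc _ _)) hc).2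
    rw [show ((m : ℝ) + 1 / 2 + (m + 1 + 1 / 2)) / 2 = m + 1 by ring] at h
    rw [Finset.sum_range_succ, ← intervalIntegral.integral_add_adjacent_intervals
      (hc.intervalIntegrable 0 (m + 1 / 2)) (hc.intervalIntegrable (m + 1 / 2) (m + 1 + 1 / 2))]
    linarith

theorem ConcaveOn.abs_sum_sub_integral_le {f : ℝ → ℝ} {X : ℝ}
    (hf : ConcaveOn ℝ (Set.Icc 0 X) f) (ha : AntitoneOn f (Set.Icc 0 X)) (hc : Continuous f)
    (h0 : ∀ x, 0 ≤ f x) (n : ℕ) (hn : (n : ℝ) + 1 ≤ X) (hX : X ≤ n + 2) :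
    |∑ k ∈ Finset.range (n + 1), f ((k : ℝ) + 1) - (∫ x in (0 : ℝ)..X, f x) + f 0 / 2|
      ≤ 3 / 2 * f n := by
  have hn0 : (0 : ℝ) ≤ n := n.cast_nonneg
  have hanti : f ((n : ℝ) + 1) ≤ f n :=
    ha ⟨hn0, by linarith⟩ ⟨by linarith, hn⟩ (by linarith)
  have hlow := hf.trapezoid_le_integral hc (n + 1) (by push_cast; exact hn)
  have hupp := hf.integral_le_midpoint ha hc n (by linarith)
  push_cast at hlow
  have htail : 0 ≤ ∫ x in (n + 1 : ℝ)..X, f x :=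
    intervalIntegral.integral_nonneg hn fun x _ => h0 x
  have htail' : ∫ x in (n + 1 / 2 : ℝ)..X, f x ≤ ∫ _ in (n + 1 / 2 : ℝ)..X, f n := by
    refine intervalIntegral.integral_mono_on (by linarith) (hc.intervalIntegrable _ _)
      (by simp) fun x hx => ?_
    exact ha ⟨hn0, by linarith⟩ ⟨by linarith [hx.1], hx.2⟩ (by linarith [hx.1])
  rw [intervalIntegral.integral_const, smul_eq_mul] at htail'
  have hmul : (X - (n + 1 / 2)) * f n ≤ 3 / 2 * f n :=
    mul_le_mul_of_nonneg_right (by linarith) (h0 _)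
  have e1 := intervalIntegral.integral_add_adjacent_intervals (μ := MeasureTheory.volume)
    (hc.intervalIntegrable 0 (n + 1)) (hc.intervalIntegrable (n + 1) X)
  have e2 := intervalIntegral.integral_add_adjacent_intervals (μ := MeasureTheory.volume)
    (hc.intervalIntegrable 0 (n + 1 / 2)) (hc.intervalIntegrable (n + 1 / 2) X)
  have hS := Finset.sum_range_succ (fun k : ℕ => f ((k : ℝ) + 1)) n
  have hp := h0 n
  have hp' := h0 ((n : ℝ) + 1)
  rw [abs_le]
  constructor <;> linarith

theorem integral_mul_one_sub_rpow {γ : ℝ} (hγ : 0 < γ) :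
    ∫ x in (0 : ℝ)..1, (x * (1 - x)) ^ γ = Gamma (γ + 1) ^ 2 / Gamma (2 * (γ + 1)) := by
  have h := Complex.betaIntegral_eq_Gamma_mul_div ((γ + 1 : ℝ) : ℂ) ((γ + 1 : ℝ) : ℂ)
    (by rw [Complex.ofReal_re]; linarith) (by rw [Complex.ofReal_re]; linarith)
  have hI : Complex.betaIntegral ((γ + 1 : ℝ) : ℂ) ((γ + 1 : ℝ) : ℂ)
      = ((∫ x in (0 : ℝ)..1, (x * (1 - x)) ^ γ : ℝ) : ℂ) := by
    rw [Complex.betaIntegral, ← intervalIntegral.integral_ofReal]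
    refine intervalIntegral.integral_congr fun x hx => ?_
    rw [Set.uIcc_of_le zero_le_one] at hx
    have hx1 : 0 ≤ 1 - x := by linarith [hx.2]
    rw [mul_rpow hx.1 hx1, Complex.ofReal_mul, Complex.ofReal_cpow hx.1, Complex.ofReal_cpow hx1]
    push_cast
    simp
  rw [hI, ← Complex.ofReal_add, Complex.Gamma_ofReal, Complex.Gamma_ofReal] at h
  rw [pow_two, two_mul]
  exact_mod_cast h

theorem integral_one_sub_sq_rpow {γ : ℝ} (hγ : 0 < γ) :
    ∫ x in (0 : ℝ)..1, (1 - x ^ 2) ^ γ = √π * Gamma (1 + γ) / (2 * Gamma (γ + 3 / 2)) := by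
  set f : ℝ → ℝ := fun x => (1 - x ^ 2) ^ γ with hf
  have hc : Continuous f :=
    (by fun_prop : Continuous fun x : ℝ => 1 - x ^ 2).rpow_const fun _ => Or.inr hγ.le
  have hneg : ∫ x in (-1 : ℝ)..0, f x = ∫ x in (0 : ℝ)..1, f x := by
    have h := intervalIntegral.integral_comp_neg (a := (0 : ℝ)) (b := 1) f
    simpa [hf] using h.symm
  have hadd := intervalIntegral.integral_add_adjacent_intervals (μ := MeasureTheory.volume)
    (hc.intervalIntegrable (-1) 0) (hc.intervalIntegrable 0 1)
  have hsub : ∫ x in (-1 : ℝ)..1, f x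
      = 2 * (4 ^ γ * ∫ x in (0 : ℝ)..1, (x * (1 - x)) ^ γ) := by
    have h := intervalIntegral.smul_integral_comp_mul_sub (a := (0 : ℝ)) (b := 1) f 2 1
    rw [show (2 : ℝ) * 0 - 1 = -1 by norm_num, show (2 : ℝ) * 1 - 1 = 1 by norm_num,
      smul_eq_mul] at h
    rw [← h, ← intervalIntegral.integral_const_mul (4 ^ γ)]
    congr 1
    refine intervalIntegral.integral_congr fun x hx => ?_
    rw [Set.uIcc_of_le zero_le_one] at hx
    have hx1 : 0 ≤ 1 - x := by linarith [hx.2]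
    simp only [hf]
    rw [← mul_rpow (by norm_num) (mul_nonneg hx.1 hx1)]
    congr 1
    ring
  have hdup := Gamma_mul_Gamma_add_half (γ + 1)
  rw [show γ + 1 + 1 / 2 = γ + 3 / 2 by ring] at hdup
  have hpow : (4 : ℝ) ^ γ * 2 ^ (1 - 2 * (γ + 1)) = 1 / 2 := by
    rw [show (4 : ℝ) = 2 ^ (2 : ℝ) by norm_num, ← rpow_mul (by norm_num),
      ← rpow_add (by norm_num), show 2 * γ + (1 - 2 * (γ + 1)) = -1 by ring, rpow_neg_one]
    norm_num
  have hG1 : Gamma (γ + 3 / 2) ≠ 0 := (Gamma_pos_of_pos (by linarith)).ne'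
  have hG2 : Gamma (2 * (γ + 1)) ≠ 0 := (Gamma_pos_of_pos (by linarith)).ne'
  rw [integral_mul_one_sub_rpow hγ] at hsub
  have hval : ∫ x in (0 : ℝ)..1, f x
      = 4 ^ γ * (Gamma (γ + 1) ^ 2 / Gamma (2 * (γ + 1))) := by linarith
  rw [hval, add_comm 1 γ]
  generalize Gamma (γ + 3 / 2) = B at *
  generalize Gamma (2 * (γ + 1)) = D at *
  generalize Gamma (γ + 1) = A at *
  field_simp
  linear_combination (4 ^ γ * A * 2) * hdup
    + 2 * A * D * √π * hpow

theorem integral_riesz_symbol {γ lam : ℝ} (hγ : 0 < γ) (hl : 0 < lam) :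
    ∫ x in (0 : ℝ)..√lam / π, (max (lam - π ^ 2 * x ^ 2) 0) ^ γ
      = Gamma (1 + γ) / (√(4 * π) * Gamma (γ + 3 / 2)) * lam ^ (γ + 1 / 2) := by
  have hs : √lam ^ 2 = lam := sq_sqrt hl.le
  have h := intervalIntegral.smul_integral_comp_mul_left (a := (0 : ℝ)) (b := 1)
    (fun x => (max (lam - π ^ 2 * x ^ 2) 0) ^ γ) (√lam / π)
  rw [mul_zero, mul_one, smul_eq_mul] at h
  rw [← h]
  have hcongr : ∫ x in (0 : ℝ)..1, (max (lam - π ^ 2 * (√lam / π * x) ^ 2) 0) ^ γ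
      = lam ^ γ * ∫ x in (0 : ℝ)..1, (1 - x ^ 2) ^ γ := by
    rw [← intervalIntegral.integral_const_mul]
    refine intervalIntegral.integral_congr fun x hx => ?_
    rw [Set.uIcc_of_le zero_le_one] at hx
    have hx1 : 0 ≤ 1 - x ^ 2 := by nlinarith [hx.1, hx.2]
    have e : lam - π ^ 2 * (√lam / π * x) ^ 2 = lam * (1 - x ^ 2) := by
      rw [mul_pow, div_pow, hs]
      field_simp
    rw [e, max_eq_left (mul_nonneg hl.le hx1), mul_rpow hl.le hx1]
  have hG1 : Gamma (γ + 3 / 2) ≠ 0 := (Gamma_pos_of_pos (by linarith)).ne'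
  have h4 : √(4 * π) = 2 * √π := by
    rw [sqrt_mul (by norm_num), show (4 : ℝ) = 2 ^ 2 by norm_num, sqrt_sq (by norm_num)]
  have hπ : √π ^ 2 = π := sq_sqrt pi_pos.le
  have hπ0 : √π ≠ 0 := (sqrt_pos.2 pi_pos).ne'
  rw [hcongr, integral_one_sub_sq_rpow hγ, h4, rpow_add hl, ← sqrt_eq_rpow]
  field_simp
  linear_combination hπ

theorem continuous_riesz_symbol {γ : ℝ} (hγ : 0 < γ) (lam : ℝ) :
    Continuous fun x : ℝ => (max (lam - π ^ 2 * x ^ 2) 0) ^ γ :=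
  (by fun_prop : Continuous fun x : ℝ => max (lam - π ^ 2 * x ^ 2) 0).rpow_const
    fun _ => Or.inr hγ.le

theorem antitoneOn_riesz_symbol {γ : ℝ} (hγ : 0 < γ) (lam : ℝ) :
    AntitoneOn (fun x : ℝ => (max (lam - π ^ 2 * x ^ 2) 0) ^ γ) (Set.Ici 0) := by
  intro x hx y _ hxy
  have hx : 0 ≤ x := hx
  refine rpow_le_rpow (le_max_right _ _) (max_le_max ?_ le_rfl) hγ.le
  gcongr

theorem mul_sq_le_of_mem_Icc {lam x : ℝ} (hl : 0 < lam) (hx : x ∈ Set.Icc 0 (√lam / π)) :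
    π ^ 2 * x ^ 2 ≤ lam := by
  have h : π * x ≤ √lam := by
    rw [mul_comm]
    exact (le_div_iff₀ pi_pos).1 hx.2
  calc π ^ 2 * x ^ 2 = (π * x) ^ 2 := by ring
    _ ≤ √lam ^ 2 := pow_le_pow_left₀ (mul_nonneg pi_pos.le hx.1) h 2
    _ = lam := sq_sqrt hl.le

theorem concaveOn_riesz_symbol {γ lam : ℝ} (hγ : γ ∈ Set.Ioc (0 : ℝ) 1) (hl : 0 < lam) :
    ConcaveOn ℝ (Set.Icc 0 (√lam / π)) fun x : ℝ => (max (lam - π ^ 2 * x ^ 2) 0) ^ γ := by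
  refine ⟨convex_Icc _ _, fun x hx y hy a b ha hb hab => ?_⟩
  have hx' := mul_sq_le_of_mem_Icc hl hx
  have hy' := mul_sq_le_of_mem_Icc hl hy
  have hxy := mul_sq_le_of_mem_Icc hl (convex_Icc _ _ hx hy ha hb hab)
  simp only [smul_eq_mul] at hxy ⊢
  rw [max_eq_left (sub_nonneg.2 hx'), max_eq_left (sub_nonneg.2 hy'),
    max_eq_left (sub_nonneg.2 hxy)]
  have h := (concaveOn_rpow hγ.1.le hγ.2).2 (Set.mem_Ici.2 (sub_nonneg.2 hx'))
    (Set.mem_Ici.2 (sub_nonneg.2 hy')) ha hb hab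
  simp only [smul_eq_mul] at h
  refine h.trans (rpow_le_rpow ?_ ?_ hγ.1.le)
  · exact add_nonneg (mul_nonneg ha (sub_nonneg.2 hx')) (mul_nonneg hb (sub_nonneg.2 hy'))
  · obtain rfl : b = 1 - a := by linarith
    nlinarith [mul_nonneg (mul_nonneg ha hb) (sq_nonneg (π * (x - y)))]

theorem riesz_mean_eq_sum {γ lam : ℝ} (hγ : 0 < γ) (hl : 0 < lam) (n : ℕ)
    (hn : √lam / π ≤ n + 1) :
    ∑' k : ℕ, (max (lam - π ^ 2 * ((k : ℝ) + 1) ^ 2) 0) ^ γ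
      = ∑ k ∈ Finset.range n, (max (lam - π ^ 2 * ((k : ℝ) + 1) ^ 2) 0) ^ γ := by
  refine tsum_eq_sum fun k hk => ?_
  have hk : (n : ℝ) ≤ k := by exact_mod_cast not_lt.1 (mt Finset.mem_range.2 hk)
  have h : √lam ≤ (k + 1) * π := (div_le_iff₀ pi_pos).1 (by linarith)
  have h2 : lam ≤ ((k + 1) * π) ^ 2 := by
    rw [← sq_sqrt hl.le]
    exact pow_le_pow_left₀ (sqrt_nonneg _) h 2
  rw [max_eq_right (by linarith [mul_pow ((k : ℝ) + 1) π 2]), zero_rpow hγ.ne']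

theorem mul_sqrt_rpow {γ lam c : ℝ} (hc : 0 ≤ c) (hl : 0 < lam) :
    (c * √lam) ^ γ = c ^ γ * lam ^ (γ / 2) := by
  rw [mul_rpow hc (sqrt_nonneg _), sqrt_eq_rpow, ← rpow_mul hl.le]
  congr 2
  ring

/-- two-term asymptotics with remainder for the Dirichlet Riesz
mean on (0,1): for γ ∈ (0,1] there is C_γ > 0 so that for all λ > 0,
|Σ_{k≥1}(λ-π²k²)₊^γ - L^sc_{γ,1} λ^{γ+1/2} + (1/2)λ^γ| ≤ C_γ λ^{γ/2}. -/
theorem dirichlet_riesz_two_term (γ : ℝ) (hγ : γ ∈ Set.Ioc (0:ℝ) 1) :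
    ∃ C : ℝ, 0 < C ∧ ∀ lam : ℝ, 0 < lam →
      |(∑' k : ℕ, (max (lam - Real.pi ^ 2 * ((k : ℝ) + 1) ^ 2) 0) ^ γ)
          - Real.Gamma (1 + γ) / (Real.sqrt (4 * Real.pi) * Real.Gamma (γ + 3 / 2))
              * lam ^ (γ + 1 / 2)
          + (1 / 2) * lam ^ γ|
        ≤ C * lam ^ (γ / 2) := by
  refine ⟨3 / 2 * (4 * π) ^ γ, by positivity, fun lam hl => ?_⟩
  rw [← integral_riesz_symbol hγ.1 hl, mul_assoc (3 / 2), ← mul_sqrt_rpow (by positivity) hl]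
  have hconc := concaveOn_riesz_symbol hγ hl
  have hanti := antitoneOn_riesz_symbol hγ.1 lam
  have hc := continuous_riesz_symbol hγ.1 lam
  have hsum := riesz_mean_eq_sum hγ.1 hl
  have hg0 : (max (lam - π ^ 2 * (0 : ℝ) ^ 2) 0) ^ γ = lam ^ γ := by simp [hl.le]
  have hs : √lam ^ 2 = lam := sq_sqrt hl.le
  have hX0 : 0 ≤ √lam / π := by positivity
  have hXπ : π * (√lam / π) = √lam := by field_simp
  set X := √lam / π with hX
  rcases lt_or_ge X 1 with hX1 | hX1
  · have hI : ∫ x in (0 : ℝ)..X, (max (lam - π ^ 2 * x ^ 2) 0) ^ γ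
        ≤ ∫ _ in (0 : ℝ)..X, lam ^ γ := by
      refine intervalIntegral.integral_mono_on hX0 (hc.intervalIntegrable _ _)
        (by simp) fun x hx => ?_
      rw [← hg0]
      exact hanti (Set.mem_Ici.2 le_rfl) hx.1 hx.1
    have hI0 : 0 ≤ ∫ x in (0 : ℝ)..X, (max (lam - π ^ 2 * x ^ 2) 0) ^ γ :=
      intervalIntegral.integral_nonneg hX0 fun x _ => rpow_nonneg (le_max_right _ _) _
    rw [intervalIntegral.integral_const, smul_eq_mul] at hI
    have hpos : 0 ≤ lam ^ γ := rpow_nonneg hl.le _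
    have hle : lam ^ γ ≤ (4 * π * √lam) ^ γ := by
      refine rpow_le_rpow hl.le ?_ hγ.1.le
      have : √lam ≤ π := by nlinarith [pi_pos]
      nlinarith [sqrt_nonneg lam, pi_pos]
    have hX2 : X * lam ^ γ ≤ lam ^ γ := by nlinarith
    rw [hsum 0 (by simpa using hX1.le), Finset.sum_range_zero, abs_le]
    constructor <;> linarith
  · obtain ⟨n, hn⟩ : ∃ n, ⌊X⌋₊ = n + 1 :=
      Nat.exists_eq_succ_of_ne_zero (Nat.floor_pos.2 hX1).ne'
    have hnX : (n : ℝ) + 1 ≤ X := by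
      have h := Nat.floor_le hX0
      rw [hn] at h
      exact_mod_cast h
    have hXn : X ≤ n + 2 := by
      have h := (Nat.lt_floor_add_one X).le
      rw [hn] at h
      push_cast at h
      linarith
    have hn0 : (0 : ℝ) ≤ n := n.cast_nonneg
    have h := hconc.abs_sum_sub_integral_le (hanti.mono fun x hx => hx.1) hc
      (fun x => rpow_nonneg (le_max_right _ _) _) n hnX hXn
    rw [hg0] at h
    rw [hsum (n + 1) (by push_cast; linarith), one_div_mul_eq_div]
    refine h.trans (mul_le_mul_of_nonneg_left ?_ (by norm_num))
    refine rpow_le_rpow (le_max_right _ _) (max_le ?_ (by positivity)) hγ.1.le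
    calc lam - π ^ 2 * (n : ℝ) ^ 2 = π ^ 2 * ((X - n) * (X + n)) := by
          rw [← hs, ← hXπ]
          ring
      _ ≤ π ^ 2 * (2 * (2 * X)) := by
          gcongr
          · linarith
          · linarith
      _ = 4 * π * √lam := by
          rw [← hXπ]
          ring
end

section
/- For fixed d ≥ 1 and β > 0, the function γ ↦ r_{γ,d}(β) is non-increasing on [0,∞), where r_{γ,d}(β) is the supremum over cuboids R ⊂ ℝ^d and λ > 0 of Tr(−Δ_R^{β√λ}−λ)₋^γ / (L^{sc}_{γ,d}|R|λ^{γ+d/2}). -/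
open Real

/-- The set of eigenvalues of the Robin Laplacian on (0,1) with parameter `b`,
characterized by the transcendental equation; each such eigenvalue is simple. -/
def RobinEV (b : ℝ) : Set ℝ :=
  {μ : ℝ | 0 < μ ∧
    2 * Real.sqrt μ * Real.cos (Real.sqrt μ)
      + (b - μ / b) * Real.sin (Real.sqrt μ) = 0}

/-- Riesz-mean summand with the paper's convention (counting function for γ = 0). -/
noncomputable def rieszWeight (γ lam μ : ℝ) : ℝ :=
  if μ ≤ lam then (lam - μ) ^ γ else 0

/-- Riesz mean of order γ of the Robin Laplacian with parameter `b` on the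
cuboid ∏ᵢ (0, l i) ⊂ ℝ^d: by separation of variables its eigenvalues are the
sums over coordinates of `μᵢ / lᵢ²` with `μᵢ` an eigenvalue of the unit-interval
problem with parameter `b * l i`. -/
noncomputable def cuboidRobinRiesz (γ : ℝ) (d : ℕ) (l : Fin d → ℝ) (b lam : ℝ) : ℝ :=
  ∑' k : (∀ i : Fin d, {μ : ℝ // μ ∈ RobinEV (b * l i)}),
    rieszWeight γ lam (∑ i, (k i : ℝ) / (l i) ^ 2)

/-- The semiclassical constant L^sc_{γ,d}. -/
noncomputable def Lsc (γ : ℝ) (d : ℕ) : ℝ :=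
  Real.Gamma (1 + γ) / ((4 * Real.pi) ^ ((d : ℝ) / 2) * Real.Gamma (1 + γ + (d : ℝ) / 2))

/-- r_{γ,d}(β): the supremum over cuboids R ⊂ ℝ^d and λ > 0 of
Tr(-Δ_R^{β√λ} - λ)₋^γ / (L^sc_{γ,d}|R|λ^{γ+d/2}). -/
noncomputable def rq (γ : ℝ) (d : ℕ) (β : ℝ) : ℝ :=
  sSup {x : ℝ | ∃ l : Fin d → ℝ, ∃ lam : ℝ, (∀ i, 0 < l i) ∧ 0 < lam ∧
    x = cuboidRobinRiesz γ d l (β * Real.sqrt lam) lam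
          / (Lsc γ d * (∏ i, l i) * lam ^ (γ + (d : ℝ) / 2))}

open MeasureTheory (volume)

theorem RobinEV.two_mul_cos_eq {b μ : ℝ} (hb : 0 < b) (h : μ ∈ RobinEV b) :
    2 * cos √μ = (√μ / b - b / √μ) * sin √μ := by
  obtain ⟨h0, h1⟩ := h
  have hk : 0 < √μ := sqrt_pos.2 h0
  have hsq : √μ ^ 2 = μ := sq_sqrt h0.le
  generalize √μ = k at *
  subst hsq
  field_simp at h1 ⊢
  linarith

theorem natFloor_div_pi_eq_iff {x : ℝ} (hx : 0 ≤ x) {n : ℕ} :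
    ⌊x / π⌋₊ = n ↔ n * π ≤ x ∧ x < (n + 1) * π := by
  rw [Nat.floor_eq_iff (div_nonneg hx pi_pos.le), le_div_iff₀ pi_pos, div_lt_iff₀ pi_pos]

theorem neg_one_pow_mul_sin_nonneg {x : ℝ} {n : ℕ} (h₁ : n * π ≤ x) (h₂ : x < (n + 1) * π) :
    0 ≤ (-1) ^ n * sin x := by
  rw [← sin_sub_nat_mul_pi]
  exact sin_nonneg_of_nonneg_of_le_pi (by linarith) (by linarith)

theorem RobinEV.injOn_natFloor {b : ℝ} (hb : 0 < b) :
    Set.InjOn (fun μ => ⌊√μ / π⌋₊) (RobinEV b) := by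
  intro μ hμ ν hν hμν
  wlog hlt : √μ < √ν generalizing μ ν
  · rcases (not_lt.1 hlt).lt_or_eq with h | h
    · exact (this hν hμ hμν.symm h).symm
    · exact ((sqrt_inj hν.1.le hμ.1.le).1 h).symm
  exfalso
  have hx : 0 < √μ := sqrt_pos.2 hμ.1
  have ex := RobinEV.two_mul_cos_eq hb hμ
  have ey := RobinEV.two_mul_cos_eq hb hν
  obtain ⟨hμ₁, hμ₂⟩ := (natFloor_div_pi_eq_iff hx.le).1 rfl
  obtain ⟨hν₁, hν₂⟩ := (natFloor_div_pi_eq_iff (hx.trans hlt).le).1 hμν.symm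
  have sx := neg_one_pow_mul_sin_nonneg hμ₁ hμ₂
  have sy := neg_one_pow_mul_sin_nonneg hν₁ hν₂
  simp only at hν₁ hν₂ sy
  generalize ⌊√μ / π⌋₊ = n at *
  generalize √μ = x at *
  generalize √ν = y at *
  have hs : 0 ≤ sin x * sin y := by
    have h := mul_nonneg sx sy
    have hn : ((-1 : ℝ) ^ n) * (-1) ^ n = 1 := by rw [← mul_pow]; simp
    calc 0 ≤ _ := h
      _ = (((-1 : ℝ) ^ n) * (-1) ^ n) * (sin x * sin y) := by ring
      _ = _ := by rw [hn, one_mul]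
  have hpos : 0 < sin (y - x) := sin_pos_of_pos_of_lt_pi (by linarith) (by linarith)
  have h₁ : x / b ≤ y / b := by gcongr
  have h₂ : b / y ≤ b / x := by gcongr
  have hsub : 2 * sin (y - x) = (sin x * sin y) * ((x / b - b / x) - (y / b - b / y)) := by
    rw [sin_sub]
    linear_combination sin y * ex - sin x * ey
  have := mul_nonneg hs (show 0 ≤ (y / b - b / y) - (x / b - b / x) by linarith)
  linarith

theorem RobinEV.exists_le_of_le {b b' : ℝ} (hb : 0 < b) (hbb' : b ≤ b') {ν : ℝ}
    (hν : ν ∈ RobinEV b') :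
    ∃ μ ∈ RobinEV b, μ ≤ ν ∧ ⌊√μ / π⌋₊ = ⌊√ν / π⌋₊ := by
  have hb' : 0 < b' := hb.trans_le hbb'
  have hy : 0 < √ν := sqrt_pos.2 hν.1
  have ey := RobinEV.two_mul_cos_eq hb' hν
  obtain ⟨hn₁, hn₂⟩ := (natFloor_div_pi_eq_iff hy.le).1 rfl
  have sy := neg_one_pow_mul_sin_nonneg hn₁ hn₂
  set n := ⌊√ν / π⌋₊
  set y := √ν with hy_def
  let h : ℝ → ℝ := fun k => (-1) ^ n * (2 * cos k + b * sinc k - k / b * sin k)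
  have hcont : ContinuousOn h (Set.Icc (n * π) y) := by
    have := continuous_sinc
    fun_prop
  have hleft : 0 < h (n * π) := by
    rcases Nat.eq_zero_or_pos n with h0 | h0
    · simp [h, h0]; positivity
    · have hne : (n : ℝ) * π ≠ 0 := by positivity
      have hn : ((-1 : ℝ) ^ n) * (-1) ^ n = 1 := by rw [← mul_pow]; simp
      simp only [h, sinc_of_ne_zero hne, sin_nat_mul_pi, cos_nat_mul_pi]
      linarith [show (-1 : ℝ) ^ n * (2 * (-1) ^ n + b * (0 / (n * π)) - n * π / b * 0) =
        2 * ((-1) ^ n * (-1) ^ n) by ring]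
  have hright : h y ≤ 0 := by
    have key : h y = ((-1) ^ n * sin y) * ((y / b' - b' / y) - (y / b - b / y)) := by
      simp only [h, sinc_of_ne_zero hy.ne']
      rw [ey]; ring
    rw [key]
    have h₁ : y / b' ≤ y / b := by gcongr
    have h₂ : b / y ≤ b' / y := by gcongr
    exact mul_nonpos_of_nonneg_of_nonpos sy (by linarith)
  obtain ⟨x, ⟨hx₁, hx₂⟩, hx⟩ := intermediate_value_Icc' hn₁ hcont ⟨hright, hleft.le⟩
  have hx0 : 0 < x := by
    refine lt_of_le_of_ne ((by positivity : (0 : ℝ) ≤ n * π).trans hx₁) ?_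
    rintro rfl
    have : n * π = 0 := le_antisymm hx₁ (by positivity)
    rw [this] at hleft
    exact hleft.ne' hx
  have hsqrt : √(x ^ 2) = x := sqrt_sq hx0.le
  refine ⟨x ^ 2, ⟨by positivity, ?_⟩, ?_, ?_⟩
  · rw [hsqrt]
    have hx' : 2 * cos x + b * sinc x - x / b * sin x = 0 :=
      (mul_eq_zero.1 hx).resolve_left (pow_ne_zero _ (by norm_num))
    rw [sinc_of_ne_zero hx0.ne'] at hx'
    field_simp at hx' ⊢
    linarith
  · rw [← sq_sqrt hν.1.le]
    gcongr
  · rw [hsqrt, natFloor_div_pi_eq_iff hx0.le]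
    exact ⟨hx₁, hx₂.trans_lt hn₂⟩

theorem RobinEV.exists_injective_le {b b' : ℝ} (hb : 0 < b) (hbb' : b ≤ b') :
    ∃ φ : RobinEV b' → RobinEV b, Function.Injective φ ∧ ∀ ν, (φ ν : ℝ) ≤ ν := by
  choose φ hφ hle hfloor using fun ν : RobinEV b' => RobinEV.exists_le_of_le hb hbb' ν.2
  refine ⟨fun ν => ⟨φ ν, hφ ν⟩, fun ν ν' h => ?_, hle⟩
  have h' : φ ν = φ ν' := congrArg Subtype.val h
  refine Subtype.ext (RobinEV.injOn_natFloor (hb.trans_le hbb') ν.2 ν'.2 ?_)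
  simp only [← hfloor, h']

theorem RobinEV.mapsTo_natFloor (b K : ℝ) :
    Set.MapsTo (fun μ => ⌊√μ / π⌋₊) {μ ∈ RobinEV b | √μ ≤ K}
      (Finset.range (⌊K / π⌋₊ + 1) : Finset ℕ) := by
  intro μ hμ
  simp only [Finset.coe_range, Set.mem_Iio, Nat.lt_succ_iff]
  exact Nat.floor_le_floor (by have := hμ.2; have := pi_pos; gcongr)

theorem RobinEV.finite_sqrt_le {b : ℝ} (hb : 0 < b) (K : ℝ) :
    {μ ∈ RobinEV b | √μ ≤ K}.Finite :=
  Set.Finite.of_injOn (RobinEV.mapsTo_natFloor b K)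
    ((RobinEV.injOn_natFloor hb).mono fun _ h => h.1) (Finset.finite_toSet _)

theorem RobinEV.ncard_sqrt_le {b : ℝ} (hb : 0 < b) {K : ℝ} (hK : 0 ≤ K) :
    ({μ ∈ RobinEV b | √μ ≤ K}.ncard : ℝ) ≤ K / π + 1 := by
  have h := Set.ncard_le_ncard_of_injOn _ (RobinEV.mapsTo_natFloor b K)
    ((RobinEV.injOn_natFloor hb).mono fun _ h => h.1) (Finset.finite_toSet _)
  rw [Set.ncard_coe_finset, Finset.card_range] at h
  calc _ ≤ ((⌊K / π⌋₊ + 1 : ℕ) : ℝ) := by exact_mod_cast h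
    _ ≤ _ := by push_cast; gcongr; exact Nat.floor_le (div_nonneg hK pi_pos.le)

theorem RobinEV.min_one_le_sqrt {β K μ : ℝ} (hβ : 0 < β) (hμ : μ ∈ RobinEV (β * K))
    (hK : √μ ≤ K) : min 1 β ≤ √μ := by
  have hk : 0 < √μ := sqrt_pos.2 hμ.1
  have hK0 : 0 < K := hk.trans_le hK
  have e := RobinEV.two_mul_cos_eq (by positivity) hμ
  generalize √μ = k at *
  by_contra! hlt
  obtain ⟨h1, hkβ⟩ := lt_min_iff.1 hlt
  have hsin : 0 < sin k := sin_pos_of_pos_of_lt_pi hk (by linarith [pi_gt_three])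
  have hsin_le : sin k ≤ k := sin_le hk.le
  have hcos : 1 - k ^ 2 / 2 ≤ cos k := one_sub_sq_div_two_le_cos
  have h₁ : k / (β * K) ≤ 1 / β := by
    rw [div_le_div_iff₀ (by positivity) hβ]; nlinarith
  have h₂ : 0 < β * K / k := by positivity
  have h₃ : 1 / β * sin k < 1 := by
    rw [one_div, inv_mul_lt_iff₀ hβ]; linarith
  nlinarith

theorem RobinEV.ncard_sqrt_le_mul {β K : ℝ} (hβ : 0 < β) (hK : 0 < K) :
    ({μ ∈ RobinEV (β * K) | √μ ≤ K}.ncard : ℝ) ≤ (1 / π + 1 / min 1 β) * K := by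
  have hc : 0 < min 1 β := lt_min one_pos hβ
  rcases Set.eq_empty_or_nonempty {μ ∈ RobinEV (β * K) | √μ ≤ K} with h | ⟨μ, hμ⟩
  · rw [h, Set.ncard_empty]; have := pi_pos; push_cast; positivity
  · have h₁ := RobinEV.ncard_sqrt_le (mul_pos hβ hK) hK.le
    have h₂ : 1 ≤ K / min 1 β :=
      (one_le_div hc).2 ((RobinEV.min_one_le_sqrt hβ hμ.1 hμ.2).trans hμ.2)
    calc _ ≤ _ := h₁
      _ ≤ K / π + K / min 1 β := by gcongr
      _ = _ := by ring

theorem rieszWeight_nonneg (γ lam μ : ℝ) : 0 ≤ rieszWeight γ lam μ := by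
  unfold rieszWeight
  split_ifs with h
  · exact rpow_nonneg (sub_nonneg.2 h) _
  · exact le_rfl

theorem rieszWeight_of_lt {γ lam μ : ℝ} (h : lam < μ) : rieszWeight γ lam μ = 0 :=
  if_neg h.not_ge

theorem rieszWeight_antitone {γ : ℝ} (hγ : 0 ≤ γ) (lam : ℝ) : Antitone (rieszWeight γ lam) := by
  intro μ ν h
  by_cases hν : ν ≤ lam
  · rw [rieszWeight, rieszWeight, if_pos hν, if_pos (h.trans hν)]
    exact rpow_le_rpow (sub_nonneg.2 hν) (by linarith) hγ
  · rw [rieszWeight_of_lt (not_le.1 hν)]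
    exact rieszWeight_nonneg _ _ _

theorem rieszWeight_le_rpow {γ lam μ : ℝ} (hγ : 0 ≤ γ) (hlam : 0 ≤ lam) (hμ : 0 ≤ μ) :
    rieszWeight γ lam μ ≤ lam ^ γ := by
  simpa [rieszWeight, hlam] using rieszWeight_antitone hγ lam hμ

section Cuboid

variable {d : ℕ} {l : Fin d → ℝ} {b lam : ℝ}

theorem cuboidEV_nonneg (k : ∀ i : Fin d, {μ : ℝ // μ ∈ RobinEV (b * l i)}) :
    0 ≤ ∑ i, (k i : ℝ) / (l i) ^ 2 :=
  Finset.sum_nonneg fun i _ => div_nonneg (k i).2.1.le (sq_nonneg _)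

theorem sqrt_le_of_cuboidEV_le (hl : ∀ i, 0 < l i)
    {k : ∀ i : Fin d, {μ : ℝ // μ ∈ RobinEV (b * l i)}}
    (hk : ∑ i, (k i : ℝ) / (l i) ^ 2 ≤ lam) (i : Fin d) : √(k i : ℝ) ≤ √lam * l i := by
  have h : (k i : ℝ) / (l i) ^ 2 ≤ lam :=
    (Finset.single_le_sum (f := fun i => (k i : ℝ) / (l i) ^ 2)
      (fun j _ => div_nonneg (k j).2.1.le (sq_nonneg _)) (Finset.mem_univ i)).trans hk
  rw [div_le_iff₀ (pow_pos (hl i) 2)] at h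
  calc √(k i : ℝ) ≤ √(lam * l i ^ 2) := sqrt_le_sqrt h
    _ = √lam * l i := by rw [sqrt_mul' _ (sq_nonneg _), sqrt_sq (hl i).le]

theorem finite_and_ncard_cuboidEV_le (hb : 0 < b) (hl : ∀ i, 0 < l i) (lam : ℝ) :
    {k : ∀ i : Fin d, {μ : ℝ // μ ∈ RobinEV (b * l i)} |
      ∑ i, (k i : ℝ) / (l i) ^ 2 ≤ lam}.Finite ∧
    {k : ∀ i : Fin d, {μ : ℝ // μ ∈ RobinEV (b * l i)} |
      ∑ i, (k i : ℝ) / (l i) ^ 2 ≤ lam}.ncard ≤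
        ∏ i, {μ ∈ RobinEV (b * l i) | √μ ≤ √lam * l i}.ncard := by
  have hfin := fun i => RobinEV.finite_sqrt_le (mul_pos hb (hl i)) (√lam * l i)
  have hmaps : Set.MapsTo (fun k i => (k i : ℝ))
      {k : ∀ i : Fin d, {μ : ℝ // μ ∈ RobinEV (b * l i)} |
        ∑ i, (k i : ℝ) / (l i) ^ 2 ≤ lam}
      (Fintype.piFinset fun i => (hfin i).toFinset : Finset (Fin d → ℝ)) := by
    intro k hk
    simp only [Finset.mem_coe, Fintype.mem_piFinset, Set.Finite.mem_toFinset]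
    exact fun i => ⟨(k i).2, sqrt_le_of_cuboidEV_le hl hk i⟩
  have hinj : Function.Injective
      (fun (k : ∀ i : Fin d, {μ : ℝ // μ ∈ RobinEV (b * l i)}) i => (k i : ℝ)) :=
    fun k k' h => funext fun i => Subtype.ext (congrFun h i)
  refine ⟨Set.Finite.of_injOn hmaps hinj.injOn (Finset.finite_toSet _), ?_⟩
  refine (Set.ncard_le_ncard_of_injOn _ hmaps hinj.injOn (Finset.finite_toSet _)).trans ?_
  rw [Set.ncard_coe_finset, Fintype.card_piFinset]
  simp only [Set.ncard_eq_toFinset_card _ (hfin _), le_refl]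

theorem cuboidRobinRiesz_eq_sum (hb : 0 < b) (hl : ∀ i, 0 < l i) (γ : ℝ) {τ : ℝ}
    (hτ : τ ≤ lam) :
    cuboidRobinRiesz γ d l b τ =
      ∑ k ∈ (finite_and_ncard_cuboidEV_le hb hl lam).1.toFinset,
        rieszWeight γ τ (∑ i, (k i : ℝ) / (l i) ^ 2) :=
  tsum_eq_sum fun k hk => rieszWeight_of_lt <| by
    simp only [Set.Finite.mem_toFinset, Set.mem_ofPred_eq, not_le] at hk
    exact hτ.trans_lt hk

theorem cuboidRobinRiesz_antitone_param {γ : ℝ} (hγ : 0 ≤ γ) (hl : ∀ i, 0 < l i)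
    {b' : ℝ} (hb : 0 < b) (hbb' : b ≤ b') (lam : ℝ) :
    cuboidRobinRiesz γ d l b' lam ≤ cuboidRobinRiesz γ d l b lam := by
  have summable : ∀ c : ℝ, 0 < c →
      Summable fun k : (∀ i : Fin d, {μ : ℝ // μ ∈ RobinEV (c * l i)}) =>
        rieszWeight γ lam (∑ i, (k i : ℝ) / (l i) ^ 2) := fun c hc =>
    summable_of_ne_finset_zero (s := (finite_and_ncard_cuboidEV_le hc hl lam).1.toFinset)
      fun k hk => rieszWeight_of_lt (by simpa using hk)
  choose φ hφ hle using fun i =>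
    RobinEV.exists_injective_le (mul_pos hb (hl i)) (mul_le_mul_of_nonneg_right hbb' (hl i).le)
  refine (summable b' (hb.trans_le hbb')).tsum_le_tsum_of_inj (fun k i => φ i (k i))
    (fun k k' h => funext fun i => hφ i (congrFun h i))
    (fun _ _ => rieszWeight_nonneg _ _ _) (fun k => rieszWeight_antitone hγ lam ?_)
    (summable b hb)
  exact Finset.sum_le_sum fun i _ => div_le_div_of_nonneg_right (hle i _) (sq_nonneg _)

theorem cuboidRobinRiesz_le {γ β : ℝ} (hγ : 0 ≤ γ) (hβ : 0 < β) (hl : ∀ i, 0 < l i)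
    (hlam : 0 < lam) :
    cuboidRobinRiesz γ d l (β * √lam) lam ≤
      (1 / π + 1 / min 1 β) ^ d * ((∏ i, l i) * lam ^ (γ + (d : ℝ) / 2)) := by
  have hs : 0 < √lam := sqrt_pos.2 hlam
  have hb : 0 < β * √lam := mul_pos hβ hs
  have hcard : ((finite_and_ncard_cuboidEV_le hb hl lam).1.toFinset.card : ℝ) ≤
      ∏ i, (1 / π + 1 / min 1 β) * (√lam * l i) := by
    have h := (finite_and_ncard_cuboidEV_le hb hl lam).2
    rw [Set.ncard_eq_toFinset_card _ (finite_and_ncard_cuboidEV_le hb hl lam).1] at h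
    refine (Nat.cast_le.2 h).trans ?_
    push_cast
    refine Finset.prod_le_prod (fun _ _ => Nat.cast_nonneg _) fun i _ => ?_
    rw [mul_assoc β]
    exact RobinEV.ncard_sqrt_le_mul hβ (mul_pos hs (hl i))
  have hpow : √lam ^ d = lam ^ ((d : ℝ) / 2) := by
    rw [sqrt_eq_rpow, ← rpow_natCast, ← rpow_mul hlam.le]
    congr 1
    ring
  rw [cuboidRobinRiesz_eq_sum hb hl γ le_rfl]
  calc _ ≤ (finite_and_ncard_cuboidEV_le hb hl lam).1.toFinset.card • lam ^ γ :=
        Finset.sum_le_card_nsmul _ _ _ fun k _ =>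
          rieszWeight_le_rpow hγ hlam.le (cuboidEV_nonneg k)
    _ ≤ (∏ i, (1 / π + 1 / min 1 β) * (√lam * l i)) * lam ^ γ := by
        rw [nsmul_eq_mul]; gcongr
    _ = _ := by
        rw [Finset.prod_mul_distrib, Finset.prod_mul_distrib, Finset.prod_const,
          Finset.prod_const, Finset.card_univ, Fintype.card_fin, hpow, rpow_add hlam]
        ring

end Cuboid

theorem Lsc_pos {γ : ℝ} (hγ : 0 ≤ γ) (d : ℕ) : 0 < Lsc γ d := by
  have := pi_pos
  exact div_pos (Gamma_pos_of_pos (by positivity))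
    (mul_pos (by positivity) (Gamma_pos_of_pos (by positivity)))

theorem bddAbove_rq {γ β : ℝ} (hγ : 0 ≤ γ) (hβ : 0 < β) (d : ℕ) :
    BddAbove {x : ℝ | ∃ l : Fin d → ℝ, ∃ lam : ℝ, (∀ i, 0 < l i) ∧ 0 < lam ∧
      x = cuboidRobinRiesz γ d l (β * √lam) lam
            / (Lsc γ d * (∏ i, l i) * lam ^ (γ + (d : ℝ) / 2))} := by
  refine ⟨(1 / π + 1 / min 1 β) ^ d / Lsc γ d, ?_⟩
  rintro _ ⟨l, lam, hl, hlam, rfl⟩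
  have hL := Lsc_pos hγ d
  have hprod : 0 < ∏ i, l i := Finset.prod_pos fun i _ => hl i
  have hpow : 0 < lam ^ (γ + (d : ℝ) / 2) := rpow_pos_of_pos hlam _
  rw [div_le_div_iff₀ (by positivity) hL]
  calc _ ≤ _ := mul_le_mul_of_nonneg_right (cuboidRobinRiesz_le hγ hβ hl hlam) hL.le
    _ = _ := by ring

theorem cuboidRobinRiesz_le_rq_mul {γ β : ℝ} (hγ : 0 ≤ γ) (hβ : 0 < β) {d : ℕ}
    {l : Fin d → ℝ} (hl : ∀ i, 0 < l i) {lam τ : ℝ} (hτ : 0 < τ) (hτlam : τ ≤ lam) :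
    cuboidRobinRiesz γ d l (β * √lam) τ ≤
      rq γ d β * (Lsc γ d * (∏ i, l i) * τ ^ (γ + (d : ℝ) / 2)) := by
  have hprod : 0 < ∏ i, l i := Finset.prod_pos fun i _ => hl i
  have hpos : 0 < Lsc γ d * (∏ i, l i) * τ ^ (γ + (d : ℝ) / 2) :=
    mul_pos (mul_pos (Lsc_pos hγ d) hprod) (rpow_pos_of_pos hτ _)
  calc _ ≤ cuboidRobinRiesz γ d l (β * √τ) τ :=
        cuboidRobinRiesz_antitone_param hγ hl (mul_pos hβ (sqrt_pos.2 hτ)) (by gcongr) τ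
    _ ≤ _ := (div_le_iff₀ hpos).1 (le_csSup (bddAbove_rq hγ hβ d) ⟨l, τ, hl, hτ, rfl⟩)

theorem integral_rpow_mul_rpow {p q a : ℝ} (hp : 0 < p) (hq : 0 < q) (ha : 0 < a) :
    ∫ x in (0 : ℝ)..a, (a - x) ^ (p - 1) * x ^ (q - 1) =
      a ^ (p + q - 1) * ProbabilityTheory.beta p q := by
  have h := Complex.betaIntegral_scaled q p ha
  have hbeta : Complex.betaIntegral q p = (ProbabilityTheory.beta p q : ℝ) := by
    rw [Complex.betaIntegral_eq_Gamma_mul_div _ _ (by simpa) (by simpa), ProbabilityTheory.beta,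
      ← Complex.ofReal_add, Complex.Gamma_ofReal, Complex.Gamma_ofReal, Complex.Gamma_ofReal,
      add_comm q p]
    push_cast
    ring
  rw [hbeta] at h
  apply Complex.ofReal_injective
  rw [← intervalIntegral.integral_ofReal, Complex.ofReal_mul, Complex.ofReal_cpow ha.le]
  convert! h using 1
  · refine intervalIntegral.integral_congr fun x hx => ?_
    rw [Set.uIcc_of_le ha.le] at hx
    push_cast [Complex.ofReal_cpow hx.1, Complex.ofReal_cpow (sub_nonneg.2 hx.2)]
    ring
  · push_cast
    ring_nf

theorem intervalIntegrable_rpow_mul_rpow {p q a : ℝ} (hp : 0 < p) (hq : 0 < q) (ha : 0 < a) :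
    IntervalIntegrable (fun x => (a - x) ^ (p - 1) * x ^ (q - 1)) volume 0 a := by
  apply intervalIntegral.intervalIntegrable_of_integral_ne_zero
  rw [integral_rpow_mul_rpow hp hq ha]
  exact (mul_pos (rpow_pos_of_pos ha _) (ProbabilityTheory.beta_pos hp hq)).ne'

theorem integral_rpow_mul_rieszWeight {p γ μ lam : ℝ} (hp : 0 < p) (hγ : 0 ≤ γ) (hμ : 0 ≤ μ)
    (hμlam : μ ≤ lam) :
    IntervalIntegrable (fun τ => (lam - τ) ^ (p - 1) * rieszWeight γ τ μ) volume 0 lam ∧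
    ∫ τ in (0 : ℝ)..lam, (lam - τ) ^ (p - 1) * rieszWeight γ τ μ =
      ProbabilityTheory.beta p (γ + 1) * rieszWeight (γ + p) lam μ := by
  have hzero : Set.EqOn (fun _ => (0 : ℝ)) (fun τ => (lam - τ) ^ (p - 1) * rieszWeight γ τ μ)
      (Set.uIoo 0 μ) := by
    intro τ hτ
    rw [Set.uIoo_of_le hμ] at hτ
    simp [rieszWeight_of_lt hτ.2]
  have hint₀ := (intervalIntegrable_const (μ := volume)).congr_uIoo hzero
  have hval₀ := intervalIntegral.integral_congr_uIoo (μ := volume) hzero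
  rw [intervalIntegral.integral_zero] at hval₀
  rcases hμlam.eq_or_lt with rfl | hlt
  · refine ⟨hint₀, hval₀.symm.trans ?_⟩
    simp [rieszWeight, zero_rpow (by linarith : γ + p ≠ 0)]
  have hshift : Set.EqOn
      (fun τ => (lam - μ - (τ - μ)) ^ (p - 1) * (τ - μ) ^ (γ + 1 - 1))
      (fun τ => (lam - τ) ^ (p - 1) * rieszWeight γ τ μ) (Set.uIoo μ lam) := by
    intro τ hτ
    rw [Set.uIoo_of_le hμlam] at hτ
    simp [rieszWeight, hτ.1.le]
  have hpos : 0 < lam - μ := sub_pos.2 hlt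
  have hq : 0 < γ + 1 := by linarith
  have hint₁ := ((intervalIntegrable_rpow_mul_rpow hp hq hpos).comp_sub_right μ).congr_uIoo
    (by simpa using hshift)
  rw [zero_add, sub_add_cancel] at hint₁
  refine ⟨hint₀.trans hint₁, ?_⟩
  rw [← intervalIntegral.integral_add_adjacent_intervals hint₀ hint₁, ← hval₀, zero_add,
    ← intervalIntegral.integral_congr_uIoo hshift,
    intervalIntegral.integral_comp_sub_right
      (fun x => (lam - μ - x) ^ (p - 1) * x ^ (γ + 1 - 1)), sub_self,
    integral_rpow_mul_rpow hp hq hpos, rieszWeight, if_pos hμlam, mul_comm]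
  ring_nf

theorem beta_mul_Lsc {γ p : ℝ} (hγ : 0 ≤ γ) (hp : 0 < p) (d : ℕ) :
    ProbabilityTheory.beta p (γ + (d : ℝ) / 2 + 1) * Lsc γ d =
      ProbabilityTheory.beta p (γ + 1) * Lsc (γ + p) d := by
  have h₁ := (Gamma_pos_of_pos (by positivity : 0 < γ + 1)).ne'
  have h₂ := (Gamma_pos_of_pos (by positivity : 0 < γ + 1 + p)).ne'
  have h₃ := (Gamma_pos_of_pos (by positivity : 0 < γ + 1 + (d : ℝ) / 2)).ne'
  have h₄ := (Gamma_pos_of_pos (by positivity : 0 < γ + 1 + p + (d : ℝ) / 2)).ne'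
  rw [ProbabilityTheory.beta, ProbabilityTheory.beta, Lsc, Lsc,
    show γ + (d : ℝ) / 2 + 1 = γ + 1 + d / 2 by ring,
    show p + (γ + 1 + (d : ℝ) / 2) = γ + 1 + p + d / 2 by ring,
    show p + (γ + 1) = γ + 1 + p by ring, show 1 + γ = γ + 1 by ring,
    show 1 + (γ + p) = γ + 1 + p by ring]
  field_simp

theorem cuboidRobinRiesz_add_le {γ p β : ℝ} (hγ : 0 ≤ γ) (hp : 0 < p) (hβ : 0 < β) {d : ℕ}
    {l : Fin d → ℝ} (hl : ∀ i, 0 < l i) {lam : ℝ} (hlam : 0 < lam) :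
    cuboidRobinRiesz (γ + p) d l (β * √lam) lam ≤
      rq γ d β * (Lsc (γ + p) d * (∏ i, l i) * lam ^ (γ + p + (d : ℝ) / 2)) := by
  have hb : 0 < β * √lam := mul_pos hβ (sqrt_pos.2 hlam)
  have hB : 0 < ProbabilityTheory.beta p (γ + 1) := ProbabilityTheory.beta_pos hp (by linarith)
  have hq : 0 < γ + (d : ℝ) / 2 + 1 := by positivity
  have hweight := fun k (hk : k ∈ (finite_and_ncard_cuboidEV_le hb hl lam).1.toFinset) =>
    integral_rpow_mul_rieszWeight hp hγ (cuboidEV_nonneg k) (by simpa using hk)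
  have hle := intervalIntegral.integral_mono_on_of_le_Ioo hlam.le
    (IntervalIntegrable.sum _ fun k hk => (hweight k hk).1)
    ((intervalIntegrable_rpow_mul_rpow hp hq hlam).const_mul
      (rq γ d β * (Lsc γ d * ∏ i, l i))) fun τ hτ => by
    have h := mul_le_mul_of_nonneg_left (cuboidRobinRiesz_le_rq_mul hγ hβ hl hτ.1 hτ.2.le)
      (rpow_nonneg (sub_nonneg.2 hτ.2.le) (p - 1))
    rw [cuboidRobinRiesz_eq_sum hb hl γ hτ.2.le, Finset.mul_sum] at h
    simp only [Finset.sum_apply, add_sub_cancel_right]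
    linarith
  simp only [Finset.sum_apply] at hle
  rw [intervalIntegral.integral_finsetSum fun k hk => (hweight k hk).1,
    Finset.sum_congr rfl fun k hk => (hweight k hk).2, ← Finset.mul_sum,
    ← cuboidRobinRiesz_eq_sum hb hl (γ + p) le_rfl, intervalIntegral.integral_const_mul,
    integral_rpow_mul_rpow hp hq hlam,
    show p + (γ + (d : ℝ) / 2 + 1) - 1 = γ + p + d / 2 by ring] at hle
  refine le_of_mul_le_mul_left (hle.trans_eq ?_) hB
  linear_combination
    rq γ d β * (∏ i, l i) * lam ^ (γ + p + (d : ℝ) / 2) * beta_mul_Lsc hγ hp d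

/-- for fixed d ≥ 1 and β > 0, γ ↦ r_{γ,d}(β) is non-increasing
on [0,∞). -/
theorem rq_antitone_in_gamma (d : ℕ) (hd : 1 ≤ d) (β : ℝ) (hβ : 0 < β) :
    AntitoneOn (fun γ => rq γ d β) (Set.Ici 0) := by
  intro γ hγ γ' hγ' hle
  rcases hle.eq_or_lt with rfl | hlt
  · exact le_rfl
  obtain ⟨p, hp, rfl⟩ : ∃ p, 0 < p ∧ γ' = γ + p := ⟨γ' - γ, sub_pos.2 hlt, by ring⟩
  refine csSup_le ⟨_, fun _ => 1, 1, fun _ => one_pos, one_pos, rfl⟩ ?_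
  rintro _ ⟨l, lam, hl, hlam, rfl⟩
  have hprod : 0 < ∏ i, l i := Finset.prod_pos fun i _ => hl i
  rw [div_le_iff₀ (mul_pos (mul_pos (Lsc_pos hγ' d) hprod) (rpow_pos_of_pos hlam _))]
  exact cuboidRobinRiesz_add_le hγ hp hβ hl hlam
end

section
/- Let β_W(γ,0) be the unique positive solution of (4/π)∫₀¹(1−s²)^γ β/(β²+s²) ds = 1. Then lim_{γ→∞} β_W(γ,0)·√γ = c*, where c* is the unique positive solution of 2e^{x²} erfc(x) = 1. -/
open Real Filter Topology intervalIntegral MeasureTheory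

/-- The complementary error function erfc(x) = (2/√π)∫_x^∞ e^{-t²} dt. -/
noncomputable def erfc (x : ℝ) : ℝ :=
  (2 / Real.sqrt Real.pi) * ∫ t in Set.Ioi x, Real.exp (-t ^ 2)

lemma integrableOn_mul_inv_one_add_sq {φ : ℝ → ℝ} (hφ : Continuous φ) (hb : ∀ t, |φ t| ≤ 1) (x : ℝ) :
    IntegrableOn (fun u => φ (x * u) * (1 + u ^ 2)⁻¹) (Set.Ioi 0) := by
  have h1 : IntegrableOn (fun u : ℝ => (1 + u ^ 2)⁻¹) (Set.Ioi 0) :=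
    integrable_inv_one_add_sq.integrableOn
  refine h1.bdd_mul (c := 1) (by fun_prop) (Eventually.of_forall fun u => hb _)

/-- Twice the average of `φ (x * u)` over the half-Cauchy density `(2 / π) / (1 + u²)`, `u > 0`. -/
noncomputable def cauchyMean (φ : ℝ → ℝ) (x : ℝ) : ℝ :=
  (4 / π) * ∫ u in Set.Ioi (0 : ℝ), φ (x * u) * (1 + u ^ 2)⁻¹

lemma tendsto_cauchyMean {ι : Type*} {l : Filter ι} [l.IsCountablyGenerated] {φ : ι → ℝ → ℝ}
    {x : ι → ℝ} {g : ℝ → ℝ} (hφ : ∀ᶠ i in l, Continuous (φ i)) (hb : ∀ᶠ i in l, ∀ t, |φ i t| ≤ 1)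
    (hlim : ∀ u, 0 < u → Tendsto (fun i => φ i (x i * u)) l (𝓝 (g u))) :
    Tendsto (fun i => cauchyMean (φ i) (x i)) l
      (𝓝 ((4 / π) * ∫ u in Set.Ioi (0 : ℝ), g u * (1 + u ^ 2)⁻¹)) := by
  refine Tendsto.const_mul _ (tendsto_integral_filter_of_dominated_convergence
    (fun u : ℝ => (1 + u ^ 2)⁻¹) ?_ ?_ integrable_inv_one_add_sq.integrableOn ?_)
  · filter_upwards [hφ, hb] with i hi hi'
    exact (integrableOn_mul_inv_one_add_sq hi hi' _).aestronglyMeasurable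
  · filter_upwards [hb] with i hi
    refine Eventually.of_forall fun u => ?_
    have : (0 : ℝ) < (1 + u ^ 2)⁻¹ := by positivity
    rw [norm_mul, Real.norm_eq_abs, Real.norm_eq_abs, abs_of_pos this]
    exact mul_le_of_le_one_left this.le (hi _)
  · filter_upwards [ae_restrict_mem measurableSet_Ioi] with u hu
    exact (hlim u hu).mul_const _

lemma cauchyMean_antitoneOn {φ : ℝ → ℝ} (hφ : Continuous φ) (hb : ∀ t, |φ t| ≤ 1)
    (ha : AntitoneOn φ (Set.Ici 0)) : AntitoneOn (cauchyMean φ) (Set.Ici 0) := by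
  intro x hx y hy hxy
  rw [Set.mem_Ici] at hx hy
  refine mul_le_mul_of_nonneg_left (setIntegral_mono_on
    (integrableOn_mul_inv_one_add_sq hφ hb _) (integrableOn_mul_inv_one_add_sq hφ hb _)
    measurableSet_Ioi fun u hu => ?_) (by positivity)
  rw [Set.mem_Ioi] at hu
  refine mul_le_mul_of_nonneg_right (ha ?_ ?_ ?_) (by positivity)
  · exact mul_nonneg hx hu.le
  · exact mul_nonneg hy hu.le
  · exact mul_le_mul_of_nonneg_right hxy hu.le

lemma cauchyMean_strictAntiOn {φ : ℝ → ℝ} (hφ : Continuous φ) (hb : ∀ t, |φ t| ≤ 1)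
    (ha : StrictAntiOn φ (Set.Ici 0)) : StrictAntiOn (cauchyMean φ) (Set.Ici 0) := by
  intro x hx y hy hxy
  rw [Set.mem_Ici] at hx hy
  have key : ∀ u ∈ Set.Ioi (0 : ℝ),
      φ (y * u) * (1 + u ^ 2)⁻¹ < φ (x * u) * (1 + u ^ 2)⁻¹ := fun u hu => by
    rw [Set.mem_Ioi] at hu
    refine mul_lt_mul_of_pos_right (ha ?_ ?_ ?_) (by positivity)
    · exact mul_nonneg hx hu.le
    · exact mul_nonneg hy hu.le
    · exact mul_lt_mul_of_pos_right hxy hu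
  refine mul_lt_mul_of_pos_left ?_ (by positivity)
  rw [← sub_pos, ← integral_sub (integrableOn_mul_inv_one_add_sq hφ hb _)
    (integrableOn_mul_inv_one_add_sq hφ hb _)]
  rw [setIntegral_pos_iff_support_of_nonneg_ae]
  · refine lt_of_lt_of_le (b := volume (Set.Ioi (0 : ℝ))) (by simp) (measure_mono fun u hu => ?_)
    exact ⟨(sub_pos.2 (key u hu)).ne', hu⟩
  · filter_upwards [ae_restrict_mem measurableSet_Ioi] with u hu
    exact (sub_pos.2 (key u hu)).le
  · exact (integrableOn_mul_inv_one_add_sq hφ hb _).sub (integrableOn_mul_inv_one_add_sq hφ hb _)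

lemma continuous_exp_neg_sq : Continuous fun t : ℝ => exp (-t ^ 2) := by fun_prop

lemma abs_exp_neg_sq_le_one (t : ℝ) : |exp (-t ^ 2)| ≤ 1 := by
  rw [abs_of_pos (exp_pos _), exp_le_one_iff]
  nlinarith [sq_nonneg t]

lemma strictAntiOn_exp_neg_sq : StrictAntiOn (fun t : ℝ => exp (-t ^ 2)) (Set.Ici 0) := by
  intro x hx y hy hxy
  rw [Set.mem_Ici] at hx hy
  exact exp_lt_exp.2 (by nlinarith)

lemma tendsto_exp_neg_mul_sq_atTop {u : ℝ} (hu : 0 < u) :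
    Tendsto (fun x : ℝ => exp (-(x * u) ^ 2)) atTop (𝓝 0) :=
  tendsto_exp_neg_atTop_nhds_zero.comp
    ((tendsto_pow_atTop two_ne_zero).comp (tendsto_id.atTop_mul_const hu))

lemma continuous_cauchyMean {φ : ℝ → ℝ} (hφ : Continuous φ) (hb : ∀ t, |φ t| ≤ 1) :
    Continuous (cauchyMean φ) :=
  continuous_iff_continuousAt.2 fun x => tendsto_cauchyMean (φ := fun _ => φ) (x := id)
    (.of_forall fun _ => hφ) (.of_forall fun _ => hb)
    fun _ _ => (hφ.comp (continuous_id.mul continuous_const)).tendsto x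

lemma hasDerivAt_integral_exp_neg_sq_mul_inv {x : ℝ} (hx : 0 < x) :
    HasDerivAt (fun y : ℝ => ∫ u in Set.Ioi (0 : ℝ), exp (-y ^ 2 * (1 + u ^ 2)) * (1 + u ^ 2)⁻¹)
      (-(√π * exp (-x ^ 2))) x := by
  have hval : ∫ u in Set.Ioi (0 : ℝ), -(2 * x) * exp (-x ^ 2 * (1 + u ^ 2)) =
      -(√π * exp (-x ^ 2)) := by
    have : ∀ u : ℝ, -(2 * x) * exp (-x ^ 2 * (1 + u ^ 2)) =
        -(2 * x) * exp (-x ^ 2) * exp (-(x ^ 2) * u ^ 2) := fun u => by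
      rw [mul_assoc, ← exp_add]; ring_nf
    simp_rw [this]
    rw [MeasureTheory.integral_const_mul, integral_gaussian_Ioi, sqrt_div pi_pos.le, sqrt_sq hx.le]
    field_simp
  rw [← hval]
  refine (_root_.hasDerivAt_integral_of_dominated_loc_of_deriv_le
    (F := fun y u => exp (-y ^ 2 * (1 + u ^ 2)) * (1 + u ^ 2)⁻¹)
    (F' := fun y u => -(2 * y) * exp (-y ^ 2 * (1 + u ^ 2)))
    (bound := fun u => 4 * x * exp (-(x / 2) ^ 2 * u ^ 2))
    (s := Set.Ioo (x / 2) (2 * x)) (Ioo_mem_nhds (by linarith) (by linarith)) ?_ ?_ ?_ ?_ ?_ ?_).2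
  · refine Eventually.of_forall fun y => Continuous.aestronglyMeasurable ?_
    have : ∀ u : ℝ, 1 + u ^ 2 ≠ 0 := fun u => by positivity
    fun_prop (disch := assumption)
  · have h1 : IntegrableOn (fun u : ℝ => (1 + u ^ 2)⁻¹) (Set.Ioi 0) :=
      integrable_inv_one_add_sq.integrableOn
    refine h1.bdd_mul (c := 1) (by fun_prop) (Eventually.of_forall fun u => ?_)
    rw [Real.norm_eq_abs, abs_of_pos (exp_pos _), exp_le_one_iff]
    have : 0 ≤ x ^ 2 * (1 + u ^ 2) := by positivity
    linarith
  · fun_prop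
  · refine Eventually.of_forall fun u y hy => ?_
    have hy0 : 0 < y := by linarith [hy.1]
    rw [norm_mul, Real.norm_eq_abs, Real.norm_eq_abs, abs_of_pos (exp_pos _), abs_neg,
      abs_of_pos (by positivity)]
    have hsq : (x / 2) ^ 2 ≤ y ^ 2 := pow_le_pow_left₀ (by positivity) hy.1.le 2
    refine mul_le_mul (by linarith [hy.2]) (exp_le_exp.2 ?_) (exp_pos _).le (by positivity)
    nlinarith [mul_le_mul_of_nonneg_right hsq (sq_nonneg u), sq_nonneg y]
  · refine Integrable.const_mul ?_ _
    exact (integrable_exp_neg_mul_sq (b := (x / 2) ^ 2) (by positivity)).integrableOn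
  · refine Eventually.of_forall fun u y _ => ?_
    have h1 : HasDerivAt (fun y : ℝ => -y ^ 2 * (1 + u ^ 2)) (-(2 * y) * (1 + u ^ 2)) y := by
      simpa using ((hasDerivAt_pow 2 y).neg.mul_const (1 + u ^ 2))
    have : 1 + u ^ 2 ≠ 0 := by positivity
    refine (h1.exp.mul_const (1 + u ^ 2)⁻¹).congr_deriv ?_
    rw [mul_assoc (exp _), mul_assoc (-(2 * y)), mul_inv_cancel₀ this, mul_one, mul_comm]

lemma cauchyMean_exp_neg_sq_eq (x : ℝ) : cauchyMean (fun t => exp (-t ^ 2)) x =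
    (4 / π) * (exp (x ^ 2) *
      ∫ u in Set.Ioi (0 : ℝ), exp (-x ^ 2 * (1 + u ^ 2)) * (1 + u ^ 2)⁻¹) := by
  rw [cauchyMean, ← MeasureTheory.integral_const_mul (exp (x ^ 2))]
  congr 1
  refine setIntegral_congr_fun (measurableSet_Ioi (a := (0 : ℝ))) fun u _ => ?_
  rw [← mul_assoc, ← exp_add]
  ring_nf

lemma tendsto_cauchyMean_exp_neg_sq_atTop :
    Tendsto (cauchyMean fun t => exp (-t ^ 2)) atTop (𝓝 0) := by
  have := tendsto_cauchyMean (φ := fun _ t => exp (-t ^ 2)) (x := id) (l := atTop) (g := fun _ => 0)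
    (.of_forall fun _ => continuous_exp_neg_sq) (.of_forall fun _ => abs_exp_neg_sq_le_one)
    fun _ hu => tendsto_exp_neg_mul_sq_atTop hu
  simpa using this

lemma cauchyMean_exp_neg_sq_zero : cauchyMean (fun t => exp (-t ^ 2)) 0 = 2 := by
  simp [cauchyMean]
  field_simp
  norm_num

lemma cauchyMean_exp_neg_sq {x : ℝ} (hx : 0 < x) :
    cauchyMean (fun t => exp (-t ^ 2)) x = 2 * exp (x ^ 2) * erfc x := by
  set J : ℝ → ℝ := fun y =>
    ∫ u in Set.Ioi (0 : ℝ), exp (-y ^ 2 * (1 + u ^ 2)) * (1 + u ^ 2)⁻¹ with hJ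
  have hJeq : ∀ y, J y = π / 4 * (exp (-y ^ 2) * cauchyMean (fun t => exp (-t ^ 2)) y) := fun y => by
    rw [cauchyMean_exp_neg_sq_eq, exp_neg]
    change J y = π / 4 * ((exp (y ^ 2))⁻¹ * (4 / π * (exp (y ^ 2) * J y)))
    field_simp
  have hlim : Tendsto J atTop (𝓝 0) := by
    have h0 : Tendsto (fun y : ℝ => exp (-y ^ 2)) atTop (𝓝 0) := by
      simpa only [mul_one] using tendsto_exp_neg_mul_sq_atTop one_pos
    have := (h0.mul tendsto_cauchyMean_exp_neg_sq_atTop).const_mul (π / 4)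
    simpa only [← hJeq, zero_mul, mul_zero] using this
  have hint : IntegrableOn (fun y : ℝ => -(√π * exp (-y ^ 2))) (Set.Ioi x) := by
    have : Integrable (fun y : ℝ => exp (-y ^ 2)) := by
      simpa using integrable_exp_neg_mul_sq one_pos
    exact (this.const_mul _).neg.integrableOn
  have h := integral_Ioi_of_hasDerivAt_of_tendsto' (f := J)
    (fun y hy => hasDerivAt_integral_exp_neg_sq_mul_inv (hx.trans_le hy)) hint hlim
  rw [MeasureTheory.integral_neg, MeasureTheory.integral_const_mul, zero_sub, neg_inj] at h
  rw [cauchyMean_exp_neg_sq_eq]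
  change 4 / π * (exp (x ^ 2) * J x) = _
  rw [← h, erfc]
  have h2 : √π ^ 2 = π := sq_sqrt pi_pos.le
  have h3 : √π ≠ 0 := (sqrt_pos.2 pi_pos).ne'
  nth_rewrite 1 [← h2]
  field_simp
  ring

lemma cauchyMean_rescale (φ : ℝ → ℝ) {b : ℝ} (hb : 0 < b) (k : ℝ) :
    (4 / π) * ∫ s in Set.Ioi (0 : ℝ), φ (k * s) * (b / (b ^ 2 + s ^ 2)) =
      cauchyMean φ (b * k) := by
  have := integral_comp_mul_left_Ioi (fun s => φ (k * s) * (b / (b ^ 2 + s ^ 2))) 0 hb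
  rw [mul_zero, smul_eq_mul, eq_inv_mul_iff_mul_eq₀ hb.ne',
    ← MeasureTheory.integral_const_mul] at this
  rw [cauchyMean, ← this]
  congr 1
  refine setIntegral_congr_fun (measurableSet_Ioi (a := (0 : ℝ))) fun u _ => ?_
  rw [show k * (b * u) = b * k * u by ring]
  have : 1 + u ^ 2 ≠ 0 := by positivity
  have : b ^ 2 + (b * u) ^ 2 ≠ 0 := by positivity
  field_simp

/-- The truncated power `(1 - t² / γ)₊ ^ γ`, approximating the Gaussian `exp (-t²)`. -/
noncomputable def truncPow (γ t : ℝ) : ℝ := (max (1 - t ^ 2 / γ) 0) ^ γ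

lemma continuous_truncPow {γ : ℝ} (hγ : 0 < γ) : Continuous (truncPow γ) :=
  Continuous.rpow_const (by fun_prop) fun _ => Or.inr hγ.le

lemma abs_truncPow_le_one {γ : ℝ} (hγ : 0 < γ) (t : ℝ) : |truncPow γ t| ≤ 1 := by
  rw [truncPow, abs_of_nonneg (rpow_nonneg (le_max_right _ _) _)]
  refine rpow_le_one (le_max_right _ _) (max_le ?_ zero_le_one) hγ.le
  have : 0 ≤ t ^ 2 / γ := by positivity
  linarith

lemma antitoneOn_truncPow {γ : ℝ} (hγ : 0 < γ) : AntitoneOn (truncPow γ) (Set.Ici 0) := by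
  intro x hx y hy hxy
  rw [Set.mem_Ici] at hx
  refine rpow_le_rpow (le_max_right _ _) (max_le_max_right _ ?_) hγ.le
  gcongr

lemma tendsto_truncPow (t : ℝ) : Tendsto (fun γ => truncPow γ t) atTop (𝓝 (exp (-t ^ 2))) := by
  refine (tendsto_one_add_div_rpow_exp (-t ^ 2)).congr' ?_
  filter_upwards [eventually_gt_atTop (t ^ 2), eventually_gt_atTop 0] with γ h1 h0
  have : t ^ 2 / γ ≤ 1 := (div_le_one h0).2 h1.le
  rw [truncPow, max_eq_left (by linarith), neg_div, sub_eq_add_neg]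

lemma integral_one_sub_sq_rpow_eq {γ b : ℝ} (hγ : 0 < γ) (hb : 0 < b) :
    (4 / π) * ∫ s in (0 : ℝ)..1, (1 - s ^ 2) ^ γ * (b / (b ^ 2 + s ^ 2)) =
      cauchyMean (truncPow γ) (b * √γ) := by
  have hT : ∀ s, truncPow γ (√γ * s) = (max (1 - s ^ 2) 0) ^ γ := fun s => by
    rw [truncPow, mul_pow, sq_sqrt hγ.le, mul_div_cancel_left₀ _ hγ.ne']
  rw [← cauchyMean_rescale _ hb, intervalIntegral.integral_of_le zero_le_one]
  congr 1
  rw [setIntegral_eq_of_subset_of_forall_sdiff_eq_zero measurableSet_Ioi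
    (show Set.Ioc (0 : ℝ) 1 ⊆ Set.Ioi 0 from Set.Ioc_subset_Ioi_self)]
  · refine setIntegral_congr_fun measurableSet_Ioc fun s hs => ?_
    simp only [hT]
    rw [max_eq_left (by nlinarith [hs.1, hs.2])]
  · rintro s ⟨hs0, hs1⟩
    rw [Set.mem_Ioi] at hs0
    have : 1 < s := by
      by_contra! hs
      exact hs1 ⟨hs0, hs⟩
    rw [hT, max_eq_right (by nlinarith), zero_rpow hγ.ne', zero_mul]

/-- if β_W(γ,0) is the unique positive solution of
(4/π)∫₀¹(1-s²)^γ β/(β²+s²) ds = 1, then β_W(γ,0)·√γ → c* as γ → ∞, where c* is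
the unique positive solution of 2e^{x²} erfc(x) = 1. -/
theorem betaW_large_gamma_limit
    (bW : ℝ → ℝ)
    (h : ∀ γ : ℝ, 0 < γ → 0 < bW γ ∧
      (4 / Real.pi) * ∫ s in (0:ℝ)..1,
          (1 - s ^ 2) ^ γ * (bW γ / ((bW γ) ^ 2 + s ^ 2)) = 1) :
    ∃ c : ℝ, 0 < c ∧ 2 * Real.exp (c ^ 2) * erfc c = 1 ∧
      (∀ c' : ℝ, 0 < c' → 2 * Real.exp (c' ^ 2) * erfc c' = 1 → c' = c) ∧
      Tendsto (fun γ => bW γ * Real.sqrt γ) atTop (nhds c) := by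
  set G := cauchyMean fun t => exp (-t ^ 2) with hG
  have hcont : Continuous G := continuous_cauchyMean continuous_exp_neg_sq abs_exp_neg_sq_le_one
  have hanti : StrictAntiOn G (Set.Ici 0) :=
    cauchyMean_strictAntiOn continuous_exp_neg_sq abs_exp_neg_sq_le_one strictAntiOn_exp_neg_sq
  have hG0 : G 0 = 2 := cauchyMean_exp_neg_sq_zero
  obtain ⟨M, hM, hM0⟩ := ((tendsto_cauchyMean_exp_neg_sq_atTop.eventually
    (gt_mem_nhds one_pos)).and (eventually_gt_atTop 0)).exists
  obtain ⟨c, hc, hGc⟩ := intermediate_value_Icc' hM0.le hcont.continuousOn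
    (show (1 : ℝ) ∈ Set.Icc (G M) (G 0) from ⟨hM.le, by rw [hG0]; norm_num⟩)
  have hc0 : 0 < c := by
    refine lt_of_le_of_ne hc.1 ?_
    rintro rfl
    rw [hG0] at hGc
    norm_num at hGc
  have hpt : ∀ x, Tendsto (fun γ => cauchyMean (truncPow γ) x) atTop (𝓝 (G x)) := fun x =>
    tendsto_cauchyMean
      ((eventually_gt_atTop 0).mono fun _ => continuous_truncPow)
      ((eventually_gt_atTop 0).mono fun _ => abs_truncPow_le_one)
      fun u _ => tendsto_truncPow (x * u)
  have hmem : ∀ γ, 0 < γ → 0 < bW γ * √γ ∧ cauchyMean (truncPow γ) (bW γ * √γ) = 1 := fun γ hγ => by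
    obtain ⟨hb, he⟩ := h γ hγ
    exact ⟨mul_pos hb (sqrt_pos.2 hγ), by rw [← integral_one_sub_sq_rpow_eq hγ hb, he]⟩
  have hmono : ∀ γ, 0 < γ → AntitoneOn (cauchyMean (truncPow γ)) (Set.Ici 0) := fun γ hγ =>
    cauchyMean_antitoneOn (continuous_truncPow hγ) (abs_truncPow_le_one hγ) (antitoneOn_truncPow hγ)
  refine ⟨c, hc0, by rw [← cauchyMean_exp_neg_sq hc0, ← hG, hGc], fun c' hc' he => ?_, ?_⟩
  · rw [← cauchyMean_exp_neg_sq hc'] at he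
    exact hanti.injOn hc'.le hc0.le (he.trans hGc.symm)
  · refine tendsto_order.2 ⟨fun a ha => ?_, fun b hb => ?_⟩
    · rcases lt_or_ge a 0 with ha0 | ha0
      · filter_upwards [eventually_gt_atTop 0] with γ hγ
        exact ha0.trans (hmem γ hγ).1
      · have h1 : 1 < G a := hGc ▸ hanti ha0 hc0.le ha
        filter_upwards [eventually_gt_atTop 0, (hpt a).eventually (lt_mem_nhds h1)] with γ hγ h2
        by_contra! hle
        have := hmono γ hγ (hmem γ hγ).1.le ha0 hle
        linarith [(hmem γ hγ).2]
    · have hb0 : 0 ≤ b := (hc0.trans hb).le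
      have h1 : G b < 1 := hGc ▸ hanti hc0.le hb0 hb
      filter_upwards [eventually_gt_atTop 0, (hpt b).eventually (gt_mem_nhds h1)] with γ hγ h2
      by_contra! hle
      have := hmono γ hγ hb0 (hmem γ hγ).1.le hle
      linarith [(hmem γ hγ).2]
end
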